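/- Let n ≥ 2. For every permutation τ = τ₁τ₂⋯τ_{n−1} of {1,…,n−1}, the unique double edge out of the cluster with signature τ goes to the cluster with signature τ₂⋯τ_{n−1}τ₁ (the left cyclic shift of τ), and every orbit of the bijection τ ↦ τ₂⋯τ_{n−1}τ₁ on the set of permutations of {1,…,n−1} has size exactly n−1; consequently, every cycle formed by the double edges passes through exactly n−1 distinct clusters. -/

import Mathlib

/-- `w` is order-isomorphic to the permutation `τ`, i.e. `red w = τ`:
`red(w)_i < red(w)_j` iff `w_i < w_j`. -/
def IsRed {m k : ℕ} (w : Fin m → Fin k) (τ : Equiv.Perm (Fin m)) : Prop :=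
  ∀ i j : Fin m, w i < w j ↔ τ i < τ j

/-- The left cyclic shift `τ₁τ₂⋯τ_{n-1} ↦ τ₂⋯τ_{n-1}τ₁` of a permutation,
viewed as a word. -/
def leftShift {m : ℕ} (τ : Equiv.Perm (Fin m)) : Equiv.Perm (Fin m) :=
  τ * finRotate m

/-- A permutation of `Fin n` is determined by its comparisons. -/
theorem perm_eq_of_lt_iff_lt {n : ℕ} {σ τ : Equiv.Perm (Fin n)}
    (h : ∀ i j, σ i < σ j ↔ τ i < τ j) : σ = τ := by
  have hmono : StrictMono (σ.symm.trans τ) := fun a b hab => by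
    simpa using (h (σ.symm a) (σ.symm b)).1 (by simpa using hab)
  have hle : ∀ a b, (σ.symm.trans τ) a ≤ (σ.symm.trans τ) b ↔ a ≤ b := fun _ _ => hmono.le_iff_le
  let e : Fin n ≃o Fin n := ⟨σ.symm.trans τ, hle _ _⟩
  ext i
  have : e (σ i) = σ i := by rw [Subsingleton.elim e (OrderIso.refl _)]; rfl
  rw [← this]
  simp [e]

theorem IsRed.unique {m k : ℕ} {w : Fin m → Fin k} {σ τ : Equiv.Perm (Fin m)}
    (hσ : IsRed w σ) (hτ : IsRed w τ) : σ = τ :=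
  perm_eq_of_lt_iff_lt fun i j => (hσ i j).symm.trans (hτ i j)

theorem leftShift_last {m : ℕ} (τ : Equiv.Perm (Fin (m + 1))) :
    leftShift τ (Fin.last m) = τ 0 := by
  simp [leftShift]

theorem leftShift_castSucc {m : ℕ} (τ : Equiv.Perm (Fin (m + 1))) (i : Fin m) :
    leftShift τ i.castSucc = τ i.succ := by
  simp [leftShift]

/-- The permutations contributing an edge from the cluster of `τ` to the cluster of `ρ`. -/
def clusterEdges {m : ℕ} (τ ρ : Equiv.Perm (Fin (m + 1))) : Set (Equiv.Perm (Fin (m + 2))) :=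
  {π | IsRed (fun i : Fin (m + 1) => π i.castSucc) τ ∧
    IsRed (fun i : Fin (m + 1) => π i.succ) ρ}

/-- Two edges between the same clusters agree on every comparison except possibly that of the
first and the last letter. -/
theorem lt_iff_lt_of_mem_clusterEdges {m : ℕ} {τ ρ : Equiv.Perm (Fin (m + 1))}
    {π π' : Equiv.Perm (Fin (m + 2))} (hπ : π ∈ clusterEdges τ ρ) (hπ' : π' ∈ clusterEdges τ ρ)
    {i j : Fin (m + 2)} (h : (i ≠ 0 ∧ j ≠ 0) ∨ (i ≠ Fin.last _ ∧ j ≠ Fin.last _)) :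
    π i < π j ↔ π' i < π' j := by
  rcases h with ⟨hi, hj⟩ | ⟨hi, hj⟩
  · obtain ⟨i, rfl⟩ := Fin.exists_succ_eq.2 hi
    obtain ⟨j, rfl⟩ := Fin.exists_succ_eq.2 hj
    exact (hπ.2 i j).trans (hπ'.2 i j).symm
  · obtain ⟨i, rfl⟩ := Fin.exists_castSucc_eq.2 hi
    obtain ⟨j, rfl⟩ := Fin.exists_castSucc_eq.2 hj
    exact (hπ.1 i j).trans (hπ'.1 i j).symm

theorem eq_of_mem_clusterEdges {m : ℕ} {τ ρ : Equiv.Perm (Fin (m + 1))}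
    {π π' : Equiv.Perm (Fin (m + 2))} (hπ : π ∈ clusterEdges τ ρ) (hπ' : π' ∈ clusterEdges τ ρ)
    (h : π 0 < π (Fin.last _) ↔ π' 0 < π' (Fin.last _)) : π = π' := by
  have hne : (0 : Fin (m + 2)) ≠ Fin.last _ := (Fin.last_pos).ne
  have h1 : π 0 ≠ π (Fin.last _) := π.injective.ne hne
  have h2 : π' 0 ≠ π' (Fin.last _) := π'.injective.ne hne
  refine perm_eq_of_lt_iff_lt fun i j => ?_
  by_cases hc : (i ≠ 0 ∧ j ≠ 0) ∨ (i ≠ Fin.last _ ∧ j ≠ Fin.last _)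
  · exact lt_iff_lt_of_mem_clusterEdges hπ hπ' hc
  · by_cases hij : i = j
    · simp [hij]
    · have : (i = 0 ∧ j = Fin.last _) ∨ (i = Fin.last _ ∧ j = 0) := by grind
      rcases this with ⟨rfl, rfl⟩ | ⟨rfl, rfl⟩
      · exact h
      · grind

theorem ncard_clusterEdges_le_two {m : ℕ} (τ ρ : Equiv.Perm (Fin (m + 1))) :
    (clusterEdges τ ρ).ncard ≤ 2 := by
  have := Set.ncard_le_ncard_of_injOn (s := clusterEdges τ ρ) (t := (Set.univ : Set Prop))
    (fun π => π 0 < π (Fin.last _)) (fun _ _ => Set.mem_univ _)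
    (fun π hπ π' hπ' h => eq_of_mem_clusterEdges hπ hπ' (iff_of_eq h))
  simpa [Set.ncard_univ] using this

/-- Two distinct edges between the same clusters force the target to be the left cyclic shift of
the source: the first and last letters must be adjacent in value. -/
theorem eq_leftShift_of_mem_clusterEdges {m : ℕ} {τ ρ : Equiv.Perm (Fin (m + 1))}
    {π π' : Equiv.Perm (Fin (m + 2))} (hπ : π ∈ clusterEdges τ ρ) (hπ' : π' ∈ clusterEdges τ ρ)
    (hne : π ≠ π') : ρ = leftShift τ := by
  have hflip : ¬ (π 0 < π (Fin.last _) ↔ π' 0 < π' (Fin.last _)) :=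
    fun h => hne (eq_of_mem_clusterEdges hπ hπ' h)
  have hadj : ∀ j : Fin (m + 2), j ≠ 0 → j ≠ Fin.last _ →
      ((π (Fin.last _) < π j ↔ π 0 < π j) ∧ (π j < π (Fin.last _) ↔ π j < π 0)) := by
    intro j h0 hl
    have hn : Fin.last (m + 1) ≠ 0 := (Fin.last_pos).ne'
    have a1 := lt_iff_lt_of_mem_clusterEdges hπ hπ' (i := j) (j := 0) (.inr ⟨hl, hn.symm⟩)
    have a2 := lt_iff_lt_of_mem_clusterEdges hπ hπ' (i := 0) (j := j) (.inr ⟨hn.symm, hl⟩)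
    have a3 := lt_iff_lt_of_mem_clusterEdges hπ hπ' (i := j) (j := Fin.last _) (.inl ⟨h0, hn⟩)
    have a4 := lt_iff_lt_of_mem_clusterEdges hπ hπ' (i := Fin.last _) (j := j) (.inl ⟨hn, h0⟩)
    have b1 := π.injective.ne h0
    have b2 := π.injective.ne hl
    have b3 := π.injective.ne hn
    have b4 := π'.injective.ne h0
    have b5 := π'.injective.ne hl
    have b6 := π'.injective.ne hn
    simp only [Fin.lt_def, ne_eq, Fin.ext_iff (a := π _), Fin.ext_iff (a := π' _)] at *
    omega
  refine IsRed.unique hπ.2 fun i j => ?_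
  have key : ∀ i : Fin m, i.succ.castSucc ≠ (0 : Fin (m + 2)) ∧
      i.succ.castSucc ≠ Fin.last (m + 1) := fun i =>
    ⟨by simp [Fin.ext_iff], (Fin.castSucc_lt_last _).ne⟩
  induction i using Fin.lastCases with
  | last =>
    induction j using Fin.lastCases with
    | last => simp
    | cast j =>
      rw [leftShift_last, leftShift_castSucc, Fin.succ_last, Fin.succ_castSucc,
        (hadj _ (key j).1 (key j).2).1]
      exact hπ.1 0 j.succ
  | cast i =>
    induction j using Fin.lastCases with
    | last =>
      rw [leftShift_last, leftShift_castSucc, Fin.succ_last, Fin.succ_castSucc,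
        (hadj _ (key i).1 (key i).2).2]
      exact hπ.1 i.succ 0
    | cast j =>
      rw [leftShift_castSucc, leftShift_castSucc, Fin.succ_castSucc, Fin.succ_castSucc]
      exact hπ.1 i.succ j.succ

/-- The permutation with last letter `v` whose initial letters are order-isomorphic to `τ`. -/
noncomputable def appendLetter {m : ℕ} (τ : Equiv.Perm (Fin (m + 1))) (v : Fin (m + 2)) :
    Equiv.Perm (Fin (m + 2)) :=
  Equiv.ofBijective (Fin.snoc (α := fun _ => Fin (m + 2)) (fun i => v.succAbove (τ i)) v) <|
    Finite.injective_iff_bijective.1 <| Fin.snoc_injective_iff.2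
      ⟨Fin.succAbove_right_injective.comp τ.injective, by simp [Fin.succAbove_ne]⟩

theorem appendLetter_last {m : ℕ} (τ : Equiv.Perm (Fin (m + 1))) (v : Fin (m + 2)) :
    appendLetter τ v (Fin.last _) = v := by
  simp [appendLetter]

theorem appendLetter_castSucc {m : ℕ} (τ : Equiv.Perm (Fin (m + 1))) (v : Fin (m + 2))
    (i : Fin (m + 1)) : appendLetter τ v i.castSucc = v.succAbove (τ i) := by
  simp [appendLetter]

theorem appendLetter_mem_clusterEdges {m : ℕ} (τ : Equiv.Perm (Fin (m + 1))) (v : Fin (m + 2))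
    (hv : v = (τ 0).castSucc ∨ v = (τ 0).succ) :
    appendLetter τ v ∈ clusterEdges τ (leftShift τ) := by
  refine ⟨fun i j => by simp [appendLetter_castSucc], fun i j => ?_⟩
  have hne : ∀ i : Fin m, (τ i.succ : ℕ) ≠ τ 0 := fun i h =>
    Fin.succ_ne_zero i (τ.injective (Fin.ext h))
  have key : ∀ i : Fin m, (v < v.succAbove (τ i.succ) ↔ τ 0 < τ i.succ) ∧
      (v.succAbove (τ i.succ) < v ↔ τ i.succ < τ 0) := by
    intro i
    have := hne i
    rw [Fin.lt_succAbove_iff_le_castSucc, Fin.succAbove_lt_iff_castSucc_lt]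
    rcases hv with rfl | rfl <;> simp only [Fin.lt_def, Fin.le_def, Fin.val_castSucc, Fin.val_succ]
      <;> grind
  induction i using Fin.lastCases with
  | last =>
    induction j using Fin.lastCases with
    | last => simp
    | cast j =>
      simp only [leftShift_last, leftShift_castSucc, Fin.succ_last, Fin.succ_castSucc,
        appendLetter_last, appendLetter_castSucc, key]
  | cast i =>
    induction j using Fin.lastCases with
    | last =>
      simp only [leftShift_last, leftShift_castSucc, Fin.succ_last, Fin.succ_castSucc,
        appendLetter_last, appendLetter_castSucc, key]
    | cast j =>
      simp only [leftShift_castSucc, Fin.succ_castSucc, appendLetter_castSucc,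
        Fin.succAbove_lt_succAbove_iff]

theorem ncard_clusterEdges_leftShift {m : ℕ} (τ : Equiv.Perm (Fin (m + 1))) :
    (clusterEdges τ (leftShift τ)).ncard = 2 := by
  refine (ncard_clusterEdges_le_two _ _).antisymm ?_
  refine (Set.one_lt_ncard (Set.toFinite _)).2 ⟨_, appendLetter_mem_clusterEdges τ _ (.inl rfl),
    _, appendLetter_mem_clusterEdges τ _ (.inr rfl), fun h => ?_⟩
  have := congrArg (fun π : Equiv.Perm _ => π (Fin.last _)) h
  simp only [appendLetter_last] at this
  exact (Fin.castSucc_lt_succ).ne this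

theorem iterate_leftShift_apply {m : ℕ} (τ : Equiv.Perm (Fin (m + 1))) (k : ℕ)
    (i : Fin (m + 1)) : (leftShift^[k] τ) i = τ (i + Fin.ofNat (m + 1) k) := by
  induction k generalizing i with
  | zero => simp
  | succ k ih =>
    rw [Function.iterate_succ_apply', leftShift, Equiv.Perm.mul_apply, ih, finRotate_apply]
    congr 1
    ext
    simp [Fin.val_add, add_assoc, add_comm 1 k]

/-- For `n ≥ 2` (written `n = m+2`): the unique double edge out of the cluster with
signature `τ` goes to the cluster with signature the left cyclic shift of `τ`
(i.e. exactly two `n`-permutations `π` satisfy `red(π₁⋯π_{n-1}) = τ` and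
`red(π₂⋯π_n) = ρ` precisely when `ρ` is the left cyclic shift of `τ`), and every
orbit of the left cyclic shift map on permutations of `{1,…,n-1}` has size exactly
`n-1`; consequently every cycle formed by the double edges passes through exactly
`n-1` distinct clusters. -/
theorem stmt3 (m : ℕ) :
    (∀ τ ρ : Equiv.Perm (Fin (m + 1)),
      {π : Equiv.Perm (Fin (m + 2)) |
        IsRed (fun i : Fin (m + 1) => π i.castSucc) τ ∧
        IsRed (fun i : Fin (m + 1) => π i.succ) ρ}.ncard = 2 ↔
      ρ = leftShift τ) ∧
    (∀ τ : Equiv.Perm (Fin (m + 1)),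
      (leftShift)^[m + 1] τ = τ ∧
      ∀ k : ℕ, 0 < k → k < m + 1 → (leftShift)^[k] τ ≠ τ) := by
  refine ⟨fun τ ρ => ⟨fun h => ?_, ?_⟩, fun τ => ⟨?_, fun k hk hkm h => ?_⟩⟩
  · obtain ⟨π, π', hne, hs⟩ := Set.ncard_eq_two.1 h
    have hπ : π ∈ clusterEdges τ ρ := hs.ge (Set.mem_insert _ _)
    have hπ' : π' ∈ clusterEdges τ ρ := hs.ge (Set.mem_insert_of_mem _ rfl)
    exact eq_leftShift_of_mem_clusterEdges hπ hπ' hne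
  · rintro rfl
    exact ncard_clusterEdges_leftShift τ
  · ext i
    rw [iterate_leftShift_apply]
    simp
  · have h0 := congrArg (fun σ : Equiv.Perm _ => σ 0) h
    simp only [iterate_leftShift_apply, zero_add] at h0
    have h1 := congrArg Fin.val (τ.injective h0)
    rw [Fin.val_ofNat, Nat.mod_eq_of_lt hkm, Fin.val_zero] at h1
    omega
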